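/- T_MSO(Fin) is an axiomatisation of the pseudofinite monadic second order theory of linear order: for every L_⊗-sentence φ, T_MSO(Fin) ⊨ φ if and only if MSO(n) ⊨ φ for every n ∈ ℕ. -/

import Mathlib

open FirstOrder FirstOrder.Language

namespace MSO

/-! ### The language `L_⊗` and its semantics -/

/-- The language `L_⊗`: a constant `⊥`, a unary relation `At`,
and two binary relations: `⊆` (encoded `true`) and `≤ᴱ` (encoded `false`). -/
def Lmso : Language where
  Functions := fun n => match n with | 0 => Unit | _ => Empty
  Relations := fun n => match n with | 1 => Unit | 2 => Bool | _ => Empty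

/-- The constant symbol `⊥`. -/
def botC : Lmso.Constants := Unit.unit
/-- The unary relation symbol `At`. -/
def atR : Lmso.Relations 1 := Unit.unit
/-- The binary relation symbol `⊆`. -/
def subR : Lmso.Relations 2 := true
/-- The binary relation symbol `≤ᴱ`. -/
def exleR : Lmso.Relations 2 := false

/-- The interpretation of `⊥` in an `L_⊗`-structure. -/
def botE (M : Type*) [Lmso.Structure M] : M := Structure.funMap botC ![]
/-- The interpretation of `At` in an `L_⊗`-structure. -/
def atE {M : Type*} [Lmso.Structure M] (a : M) : Prop := Structure.RelMap atR ![a]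
/-- The interpretation of `⊆` in an `L_⊗`-structure. -/
def subE {M : Type*} [Lmso.Structure M] (a b : M) : Prop := Structure.RelMap subR ![a, b]
/-- The interpretation of `≤ᴱ` in an `L_⊗`-structure. -/
def exleE {M : Type*} [Lmso.Structure M] (a b : M) : Prop := Structure.RelMap exleR ![a, b]

/-- The monadic second order version `M̃SO(α)` of a linear order `α`, as an `L_⊗`-structure:
the universe is the powerset of `α`, `⊆` is inclusion, `⊥` is `∅`, `At` holds of singletons,
and `A ≤ᴱ B` iff there are `a ∈ A` and `b ∈ B` with `a < b`. -/
instance msoStructure (α : Type*) [LinearOrder α] : Lmso.Structure (Set α) where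
  funMap := fun {n} f _ => match n, f with
    | 0, _ => (∅ : Set α)
  RelMap := fun {n} r v => match n, r with
    | 1, _ => ∃ a : α, v 0 = {a}
    | 2, true => v 0 ⊆ v 1
    | 2, false => ∃ a ∈ v 0, ∃ b ∈ v 1, a < b

/-- `MSO(n)`, the monadic second order version of the `n`-element linear order. -/
abbrev MSOn (n : ℕ) : Type := Set (Fin n)

/-- The operation `⊗` on `L_⊗`-structures: the universe is the product, `⊆` is componentwise,
`⊥` is the pair of bottoms, `At` holds of the atoms (minimal non-bottom elements) of the
resulting order, and `(A,B) ≤ᴱ (C,D)` iff (`A ≠ ⊥` and `D ≠ ⊥`), or `A ≤ᴱ C`, or `B ≤ᴱ D`. -/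
instance tensorStructure (M N : Type*) [Lmso.Structure M] [Lmso.Structure N] :
    Lmso.Structure (M × N) where
  funMap := fun {n} f _ => match n, f with
    | 0, _ => (botE M, botE N)
  RelMap := fun {n} r v => match n, r with
    | 1, _ => v 0 ≠ (botE M, botE N) ∧
        ∀ q : M × N, subE q.1 (v 0).1 → subE q.2 (v 0).2 →
          q = (botE M, botE N) ∨ q = v 0
    | 2, true => subE (v 0).1 (v 1).1 ∧ subE (v 0).2 (v 1).2
    | 2, false => ((v 0).1 ≠ botE M ∧ (v 1).2 ≠ botE N) ∨
        exleE (v 0).1 (v 1).1 ∨ exleE (v 0).2 (v 1).2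

/-! ### Formulas -/

/-- Bounded `L_⊗`-formulas with no free (outer) variables. -/
abbrev BF (n : ℕ) := Lmso.BoundedFormula Empty n

/-- The `i`-th de Bruijn variable as a term. -/
def tv {n : ℕ} (i : Fin n) : Lmso.Term (Empty ⊕ Fin n) := Term.var (Sum.inr i)
/-- The constant `⊥` as a term. -/
def tb {n : ℕ} : Lmso.Term (Empty ⊕ Fin n) := Constants.term botC

def sub' {n : ℕ} (i j : Fin n) : BF n := subR.boundedFormula₂ (tv i) (tv j)
def exle' {n : ℕ} (i j : Fin n) : BF n := exleR.boundedFormula₂ (tv i) (tv j)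
def at' {n : ℕ} (i : Fin n) : BF n := atR.boundedFormula₁ (tv i)
def eq' {n : ℕ} (i j : Fin n) : BF n := Term.bdEqual (tv i) (tv j)
def isBot' {n : ℕ} (i : Fin n) : BF n := Term.bdEqual (tv i) tb
def botSub' {n : ℕ} (i : Fin n) : BF n := subR.boundedFormula₂ tb (tv i)

/-- Finite conjunction. -/
def bigAnd {n : ℕ} (l : List (BF n)) : BF n := l.foldr (· ⊓ ·) ⊤
/-- Finite disjunction. -/
def bigOr {n : ℕ} (l : List (BF n)) : BF n := l.foldr (· ⊔ ·) ⊥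

/-- `k` is the meet of `i` and `j` (with respect to `⊆`). -/
def isMeet {n : ℕ} (k i j : Fin n) : BF n :=
  sub' k i ⊓ sub' k j ⊓
    ∀' ((sub' (Fin.last n) i.castSucc ⊓ sub' (Fin.last n) j.castSucc) ⟹
      sub' (Fin.last n) k.castSucc)

/-- `k` is the join of `i` and `j` (with respect to `⊆`). -/
def isJoin {n : ℕ} (k i j : Fin n) : BF n :=
  sub' i k ⊓ sub' j k ⊓
    ∀' ((sub' i.castSucc (Fin.last n) ⊓ sub' j.castSucc (Fin.last n)) ⟹
      sub' k.castSucc (Fin.last n))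

/-- The meet of `i` and `j` is `⊥`. -/
def meetIsBot {n : ℕ} (i j : Fin n) : BF n :=
  ∀' ((sub' (Fin.last n) i.castSucc ⊓ sub' (Fin.last n) j.castSucc) ⟹ isBot' (Fin.last n))

/-- The join of `i` and `j` is the top element. -/
def joinIsTop {n : ℕ} (i j : Fin n) : BF n :=
  ∀' ((sub' i.castSucc (Fin.last n) ⊓ sub' j.castSucc (Fin.last n)) ⟹
    ∀' (sub' (Fin.last (n + 1)) ((Fin.last n).castSucc)))

/-- `j` is a (Boolean) complement of `i`. -/
def isComplOf {n : ℕ} (j i : Fin n) : BF n := meetIsBot i j ⊓ joinIsTop i j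

/-- `i` is an atom: non-bottom, and minimal among non-bottom elements. -/
def isAtomDef {n : ℕ} (i : Fin n) : BF n :=
  ∼(isBot' i) ⊓
    ∀' (sub' (Fin.last n) i.castSucc ⟹ (isBot' (Fin.last n) ⊔ eq' (Fin.last n) i.castSucc))

/-! ### The base theory `T_base` -/

def axRefl : Lmso.Sentence := ∀' sub' 0 0
def axAntisymm : Lmso.Sentence := ∀' ∀' ((sub' 0 1 ⊓ sub' 1 0) ⟹ eq' 0 1)
def axTrans : Lmso.Sentence := ∀' ∀' ∀' ((sub' 0 1 ⊓ sub' 1 2) ⟹ sub' 0 2)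
def axBotLe : Lmso.Sentence := ∀' botSub' 0
def axTop : Lmso.Sentence := ∃' ∀' (sub' 1 0)
def axMeet : Lmso.Sentence := ∀' ∀' ∃' (isMeet 2 0 1)
def axJoin : Lmso.Sentence := ∀' ∀' ∃' (isJoin 2 0 1)
def axCompl : Lmso.Sentence := ∀' ∃' (isComplOf 1 0)
def axDistrib : Lmso.Sentence :=
  ∀' ∀' ∀' ∀' ∀' ∀' ∀' ∀'
    ((isMeet 3 0 1 ⊓ isMeet 4 0 2 ⊓ isJoin 5 1 2 ⊓ isMeet 6 0 5 ⊓ isJoin 7 3 4) ⟹ sub' 6 7)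
def axAt : Lmso.Sentence := ∀' (at' 0 ⇔ isAtomDef 0)
def axAtomic : Lmso.Sentence := ∀' (∼(isBot' 0) ⟹ ∃' (at' 1 ⊓ sub' 1 0))
def axIrrefl : Lmso.Sentence := ∀' (at' 0 ⟹ ∼(exle' 0 0))
def axTransAt : Lmso.Sentence :=
  ∀' ∀' ∀' ((at' 0 ⊓ at' 1 ⊓ at' 2 ⊓ exle' 0 1 ⊓ exle' 1 2) ⟹ exle' 0 2)
def axTrich : Lmso.Sentence :=
  ∀' ∀' ((at' 0 ⊓ at' 1) ⟹ (exle' 0 1 ⊔ eq' 0 1 ⊔ exle' 1 0))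
def axExleDef : Lmso.Sentence :=
  ∀' ∀' (exle' 0 1 ⇔ ∃' ∃' (at' 2 ⊓ at' 3 ⊓ sub' 2 0 ⊓ sub' 3 1 ⊓ exle' 2 3))

/-- The comprehension axiom for a formula `η(x; Y₁,…,Yₙ)` (with `x` the last variable):
`∀ Ȳ ∃ X ∀ x (At x → (x ⊆ X ↔ η(x; Ȳ)))`. -/
def compAx {n : ℕ} (η : BF (n + 1)) : Lmso.Sentence :=
  BoundedFormula.alls (∃' ∀' (at' (Fin.last (n + 1)) ⟹
    (sub' (Fin.last (n + 1)) ((Fin.last n).castSucc) ⇔ η.liftAt 1 n)))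

/-- The base theory `T_base`: an atomic Boolean algebra under `⊆` with bottom `⊥`, `At`
holding exactly of the atoms, `≤ᴱ` linearly ordering the atoms and determined by its
restriction to the atoms, together with the comprehension scheme. -/
def Tbase : Lmso.Theory :=
  {axRefl, axAntisymm, axTrans, axBotLe, axTop, axMeet, axJoin, axCompl, axDistrib,
    axAt, axAtomic, axIrrefl, axTransAt, axTrich, axExleDef} ∪
  ⋃ n : ℕ, Set.range (compAx (n := n))

/-! ### The theory `T_MSO(Fin)` -/

/-- `i` is the `≤ᴱ`-least atom. -/
def isLeastAtom {n : ℕ} (i : Fin n) : BF n :=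
  at' i ⊓ ∀' (at' (Fin.last n) ⟹ ∼(exle' (Fin.last n) i.castSucc))

/-- `i` is the `≤ᴱ`-greatest atom. -/
def isGreatestAtom {n : ℕ} (i : Fin n) : BF n :=
  at' i ⊓ ∀' (at' (Fin.last n) ⟹ ∼(exle' i.castSucc (Fin.last n)))

/-- `j` is the immediate `≤ᴱ`-successor of the atom `i`. -/
def isSuccOf {n : ℕ} (j i : Fin n) : BF n :=
  at' i ⊓ at' j ⊓ exle' i j ⊓
    ∀' ((at' (Fin.last n) ⊓ exle' i.castSucc (Fin.last n)) ⟹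
      (eq' (Fin.last n) j.castSucc ⊔ exle' j.castSucc (Fin.last n)))

def axLeastAtom : Lmso.Sentence := (∃' at' 0) ⟹ ∃' isLeastAtom 0
def axGreatestAtom : Lmso.Sentence := (∃' at' 0) ⟹ ∃' isGreatestAtom 0
def axSucc : Lmso.Sentence :=
  ∀' ((at' 0 ⊓ ∃' (at' 1 ⊓ exle' 0 1)) ⟹ ∃' isSuccOf 1 0)
def axPred : Lmso.Sentence :=
  ∀' ((at' 0 ⊓ ∃' (at' 1 ⊓ exle' 1 0)) ⟹ ∃' isSuccOf 0 1)
def axLeastIn : Lmso.Sentence :=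
  ∀' (∼(isBot' 0) ⟹ ∃' (at' 1 ⊓ sub' 1 0 ⊓ ∀' ((at' 2 ⊓ sub' 2 0) ⟹ ∼(exle' 2 1))))

/-- The theory `T_MSO(Fin)`: `T_base` together with axioms saying that the ordering of the
atoms is discrete with endpoints, and every non-bottom element contains a least atom. -/
def TMSOFin : Lmso.Theory :=
  Tbase ∪ {axLeastAtom, axGreatestAtom, axSucc, axPred, axLeastIn}

/-! ### Quantifier rank, unnested formulas, and `≈ₖ` -/

/-- Quantifier rank of a bounded formula. -/
def qr : ∀ {n : ℕ}, BF n → ℕ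
  | _, BoundedFormula.falsum => 0
  | _, BoundedFormula.equal _ _ => 0
  | _, BoundedFormula.rel _ _ => 0
  | _, BoundedFormula.imp f g => max (qr f) (qr g)
  | _, BoundedFormula.all f => qr f + 1

/-- A formula is unnested if every atomic subformula is of one of the forms
`x = y`, `c = y`, or `R x̄` with the `xᵢ`, `y` variables (Hodges). -/
def IsUnnested : ∀ {n : ℕ}, BF n → Prop
  | _, BoundedFormula.falsum => True
  | _, BoundedFormula.equal s t =>
      (∃ i j, s = Term.var i ∧ t = Term.var j) ∨
      (∃ (c : Lmso.Constants) (j : _), s = Constants.term c ∧ t = Term.var j)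
  | _, BoundedFormula.rel _ ts => ∀ i, ∃ j, ts i = Term.var j
  | _, BoundedFormula.imp f g => IsUnnested f ∧ IsUnnested g
  | _, BoundedFormula.all f => IsUnnested f

/-- `M ≈ₖ N` : `M` and `N` satisfy the same unnested `L_⊗`-sentences of quantifier
rank at most `k`. -/
def EquivK (k : ℕ) (M N : Type*) [Lmso.Structure M] [Lmso.Structure N] : Prop :=
  ∀ φ : Lmso.Sentence, IsUnnested φ → qr φ ≤ k → (M ⊨ φ ↔ N ⊨ φ)

/-! ### The sentences `ρ_{d,h}`, `ψ_{>n}`, `ψ_{=n}` -/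

/-- The index (in `Fin d`) of `A_h` among `A₁, …, A_d`, identifying `h = 0` with `h = d`. -/
def aIdx (d h : ℕ) (hd : 0 < d) : Fin d := ⟨(h + d - 1) % d, Nat.mod_lt _ hd⟩

/-- The cyclic successor on the indices `{1, …, d}`. -/
def cyc {d : ℕ} (j : Fin d) : Fin d := ⟨((j : ℕ) + 1) % d, Nat.mod_lt _ j.pos⟩

/-- The sentence `ρ_{d,h}`: there is a partition of the atoms into `d` non-bottom elements
`A₁, …, A_d` such that the least atom is in `A₁`, the immediate successor of an atom lying in
`A_j` lies in `A_{j+1}` (cyclically), and the greatest atom is in `A_h`. -/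
def rho (d h : ℕ) : Lmso.Sentence :=
  if hd : 0 < d then
    BoundedFormula.exs (n := d) (
      -- each `A_i` is non-bottom
      bigAnd ((List.finRange d).map fun i => ∼(isBot' i)) ⊓
      -- every atom lies in some `A_i`
      (∀' (at' (Fin.last d) ⟹
        bigOr ((List.finRange d).map fun i => sub' (Fin.last d) i.castSucc))) ⊓
      -- the `A_i` are pairwise disjoint on atoms
      bigAnd ((List.finRange d).flatMap fun i => (List.finRange d).filterMap fun j =>
        if i.val < j.val then
          some (∀' (at' (Fin.last d) ⟹
            ∼(sub' (Fin.last d) i.castSucc ⊓ sub' (Fin.last d) j.castSucc)))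
        else none) ⊓
      -- the least atom lies in `A₁`
      (∀' (isLeastAtom (Fin.last d) ⟹ sub' (Fin.last d) ((aIdx d 1 hd).castSucc))) ⊓
      -- immediate successors move cyclically through the `A_j`
      bigAnd ((List.finRange d).map fun j =>
        ∀' ∀' ((sub' ((Fin.last d).castSucc) (j.castSucc.castSucc) ⊓
            isSuccOf (Fin.last (d + 1)) ((Fin.last d).castSucc)) ⟹
          sub' (Fin.last (d + 1)) ((cyc j).castSucc.castSucc))) ⊓
      -- the greatest atom lies in `A_h`
      (∀' (isGreatestAtom (Fin.last d) ⟹ sub' (Fin.last d) ((aIdx d h hd).castSucc))))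
  else ⊥

/-- The list of formulas `xᵢ ≠ xⱼ` for `i < j < n`. -/
def distinctPairs (n : ℕ) : List (BF n) :=
  (List.finRange n).flatMap fun i => (List.finRange n).filterMap fun j =>
    if i.val < j.val then some (∼(eq' i j)) else none

/-- `ψ_{>n}` : there exist at least `n + 1` distinct atoms. -/
def psiGt (n : ℕ) : Lmso.Sentence :=
  BoundedFormula.exs (n := n + 1)
    (bigAnd ((List.finRange (n + 1)).map fun i => at' i) ⊓ bigAnd (distinctPairs (n + 1)))

/-- `ψ_{=n}` : there exist exactly `n` distinct atoms. -/
def psiEq (n : ℕ) : Lmso.Sentence :=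
  BoundedFormula.exs (n := n)
    (bigAnd ((List.finRange n).map fun i => at' i) ⊓ bigAnd (distinctPairs n) ⊓
      ∀' (at' (Fin.last n) ⟹ bigOr ((List.finRange n).map fun i => eq' (Fin.last n) i.castSucc)))

/-! ### Residue functions and the theories `T_r̃` -/

/-- A residue function `ℙ × ℕ_{>0} → ℕ` (conditions imposed only at primes `p` and `j ≥ 1`):
`r(p,j) < p^j` and `r(p,j+1) ≡ r(p,j) [MOD p^j]`. -/
def IsResidueFunction (r : ℕ → ℕ → ℕ) : Prop :=
  ∀ p j : ℕ, p.Prime → 1 ≤ j → r p j < p ^ j ∧ r p (j + 1) ≡ r p j [MOD p ^ j]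

/-- A function `ℕ_{>1} → ℕ` is a residue function if it arises from a residue function
`ℙ × ℕ_{>0} → ℕ` as in the paper (conditions imposed only for `d > 1`). -/
def IsResidueFunctionTilde (rt : ℕ → ℕ) : Prop :=
  ∃ r : ℕ → ℕ → ℕ, IsResidueFunction r ∧
    ∀ d : ℕ, 1 < d → rt d < d ∧
      ∀ p j : ℕ, p.Prime → 1 ≤ j → p ^ j ∣ d → rt d ≡ r p j [MOD p ^ j]

/-- The theory `T_r̃ = T_MSO(Fin) ∪ {ψ_{>n} : n ∈ ℕ} ∪ {ρ_{d,r̃(d)} : d > 1}`. -/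
def Trt (rt : ℕ → ℕ) : Lmso.Theory :=
  TMSOFin ∪ Set.range psiGt ∪ {σ : Lmso.Sentence | ∃ d : ℕ, 1 < d ∧ σ = rho d (rt d)}

/-! ### Relativization and the sum of sentences -/

/-- Relativization of a formula to the elements `⊆ v`:
each quantifier `∀ Z (…)` becomes `∀ Z (Z ⊆ v → …)`. -/
def relv : ∀ {n : ℕ}, BF n → Fin n → BF n
  | _, BoundedFormula.falsum, _ => BoundedFormula.falsum
  | _, BoundedFormula.equal s t, _ => BoundedFormula.equal s t
  | _, BoundedFormula.rel r ts, _ => BoundedFormula.rel r ts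
  | _, BoundedFormula.imp f g, v => (relv f v).imp (relv g v)
  | n, BoundedFormula.all f, v =>
      BoundedFormula.all (sub' (Fin.last n) v.castSucc ⟹ relv f v.castSucc)

/-- `i` is downward closed with respect to the `≤ᴱ`-ordering of the atoms. -/
def dwcl' {n : ℕ} (i : Fin n) : BF n :=
  ∀' ∀' ((at' ((Fin.last n).castSucc) ⊓ at' (Fin.last (n + 1)) ⊓
      sub' ((Fin.last n).castSucc) (i.castSucc.castSucc) ⊓
      exle' (Fin.last (n + 1)) ((Fin.last n).castSucc)) ⟹
    sub' (Fin.last (n + 1)) (i.castSucc.castSucc))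

/-- The sentence `φ + ψ` : `∃ X (X downward closed ∧ φ^X ∧ ψ^(Xᶜ))`
(with the complement `Xᶜ` introduced by an existential quantifier). -/
def plusSent (φ ψ : Lmso.Sentence) : Lmso.Sentence :=
  ∃' ∃' (dwcl' (0 : Fin 2) ⊓ isComplOf (1 : Fin 2) (0 : Fin 2) ⊓
    relv (φ.liftAt 2 0) (0 : Fin 2) ⊓ relv (ψ.liftAt 2 0) (1 : Fin 2))

/-! ### `FSpec` and ultimate periodicity -/

/-- `FSpec φ` : the set of `n ∈ ℕ` such that `MSO(n) ⊨ φ`. -/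
def FSpec (φ : Lmso.Sentence) : Set ℕ := {n : ℕ | MSOn n ⊨ φ}

/-- A set of naturals is ultimately periodic. -/
def UltPeriodic (S : Set ℕ) : Prop :=
  ∃ N d : ℕ, 0 < d ∧ ∀ n : ℕ, N < n → (n ∈ S ↔ n + d ∈ S)

/-! ### The language `L_MO = {⊆, <}` -/

/-- The language `L_MO` with two binary relations: `⊆` (encoded `true`) and `<`
(encoded `false`). -/
def Lmo : Language where
  Functions := fun _ => Empty
  Relations := fun n => match n with | 2 => Bool | _ => Empty

/-- The monadic second order version `MSO(α)` of a linear order `α` as an `L_MO`-structure: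
`⊆` is inclusion and `<` is the ordering of `α` on singletons. -/
instance moStructure (α : Type*) [LinearOrder α] : Lmo.Structure (Set α) where
  funMap := fun f _ => f.elim
  RelMap := fun {n} r v => match n, r with
    | 2, true => v 0 ⊆ v 1
    | 2, false => ∃ a b : α, v 0 = {a} ∧ v 1 = {b} ∧ a < b

/-! ### Semantics of the basic formulas and of the axioms -/

section Semantics

variable {M : Type*} [Lmso.Structure M] {n : ℕ} {v : Empty → M} {xs : Fin n → M}

@[simp]
theorem realize_sub' (i j : Fin n) :
    (sub' i j).Realize v xs ↔ subE (xs i) (xs j) := by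
  simp [sub', tv, subE]

@[simp]
theorem realize_exle' (i j : Fin n) :
    (exle' i j).Realize v xs ↔ exleE (xs i) (xs j) := by
  simp [exle', tv, exleE]

@[simp]
theorem realize_at' (i : Fin n) : (at' i).Realize v xs ↔ atE (xs i) := by
  simp [at', tv, atE]

@[simp]
theorem realize_eq' (i j : Fin n) : (eq' i j).Realize v xs ↔ xs i = xs j := by
  simp [eq', tv]

theorem realize_tb : (tb : Lmso.Term (Empty ⊕ Fin n)).realize (Sum.elim v xs) = botE M := by
  simp [tb, botE, constantMap, Subsingleton.elim (default : Fin 0 → M) (![])]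

@[simp]
theorem realize_isBot' (i : Fin n) : (isBot' i).Realize v xs ↔ xs i = botE M := by
  simp [isBot', tv, realize_tb]

@[simp]
theorem realize_botSub' (i : Fin n) :
    (botSub' i).Realize v xs ↔ subE (botE M) (xs i) := by
  simp [botSub', tv, realize_tb, subE]

@[simp]
theorem realize_isMeet (k i j : Fin n) : (isMeet k i j).Realize v xs ↔
    (subE (xs k) (xs i) ∧ subE (xs k) (xs j)) ∧
      ∀ z, subE z (xs i) → subE z (xs j) → subE z (xs k) := by
  simp [isMeet]

@[simp]
theorem realize_isJoin (k i j : Fin n) : (isJoin k i j).Realize v xs ↔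
    (subE (xs i) (xs k) ∧ subE (xs j) (xs k)) ∧
      ∀ z, subE (xs i) z → subE (xs j) z → subE (xs k) z := by
  simp [isJoin]

@[simp]
theorem realize_isComplOf (j i : Fin n) : (isComplOf j i).Realize v xs ↔
    (∀ z, subE z (xs i) → subE z (xs j) → z = botE M) ∧
      ∀ z, subE (xs i) z → subE (xs j) z → ∀ w, subE w z := by
  simp [isComplOf, meetIsBot, joinIsTop]

@[simp]
theorem realize_isAtomDef (i : Fin n) : (isAtomDef i).Realize v xs ↔
    xs i ≠ botE M ∧ ∀ z, subE z (xs i) → z = botE M ∨ z = xs i := by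
  simp [isAtomDef]

@[simp]
theorem realize_isLeastAtom (i : Fin n) : (isLeastAtom i).Realize v xs ↔
    atE (xs i) ∧ ∀ z, atE z → ¬ exleE z (xs i) := by
  simp [isLeastAtom]

@[simp]
theorem realize_isGreatestAtom (i : Fin n) : (isGreatestAtom i).Realize v xs ↔
    atE (xs i) ∧ ∀ z, atE z → ¬ exleE (xs i) z := by
  simp [isGreatestAtom]

@[simp]
theorem realize_isSuccOf (j i : Fin n) : (isSuccOf j i).Realize v xs ↔
    ((atE (xs i) ∧ atE (xs j)) ∧ exleE (xs i) (xs j)) ∧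
      ∀ z, atE z → exleE (xs i) z → z = xs j ∨ exleE (xs j) z := by
  simp [isSuccOf]

theorem models_axRefl : M ⊨ axRefl ↔ ∀ x : M, subE x x := by
  simp [axRefl, Sentence.Realize, Formula.Realize, Fin.snoc]

theorem models_axAntisymm : M ⊨ axAntisymm ↔ ∀ x y : M, subE x y → subE y x → x = y := by
  simp [axAntisymm, Sentence.Realize, Formula.Realize, Fin.snoc]

theorem models_axTrans :
    M ⊨ axTrans ↔ ∀ x y z : M, subE x y → subE y z → subE x z := by
  simp [axTrans, Sentence.Realize, Formula.Realize, Fin.snoc]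

theorem models_axBotLe : M ⊨ axBotLe ↔ ∀ x : M, subE (botE M) x := by
  simp [axBotLe, Sentence.Realize, Formula.Realize, Fin.snoc]

theorem models_axTop : M ⊨ axTop ↔ ∃ x : M, ∀ y, subE y x := by
  simp [axTop, Sentence.Realize, Formula.Realize, Fin.snoc]

theorem models_axMeet : M ⊨ axMeet ↔ ∀ x y : M, ∃ k, (subE k x ∧ subE k y) ∧
    ∀ z, subE z x → subE z y → subE z k := by
  simp [axMeet, Sentence.Realize, Formula.Realize, Fin.snoc]

theorem models_axJoin : M ⊨ axJoin ↔ ∀ x y : M, ∃ k, (subE x k ∧ subE y k) ∧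
    ∀ z, subE x z → subE y z → subE k z := by
  simp [axJoin, Sentence.Realize, Formula.Realize, Fin.snoc]

theorem models_axCompl : M ⊨ axCompl ↔ ∀ x : M, ∃ y,
    (∀ z, subE z x → subE z y → z = botE M) ∧
      ∀ z, subE x z → subE y z → ∀ w, subE w z := by
  simp [axCompl, Sentence.Realize, Formula.Realize, Fin.snoc]

theorem models_axDistrib : M ⊨ axDistrib ↔ ∀ a b c d e f g h : M,
    ((subE d a ∧ subE d b) ∧ ∀ z, subE z a → subE z b → subE z d) →
    ((subE e a ∧ subE e c) ∧ ∀ z, subE z a → subE z c → subE z e) →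
    ((subE b f ∧ subE c f) ∧ ∀ z, subE b z → subE c z → subE f z) →
    ((subE g a ∧ subE g f) ∧ ∀ z, subE z a → subE z f → subE z g) →
    ((subE d h ∧ subE e h) ∧ ∀ z, subE d z → subE e z → subE h z) → subE g h := by
  simp only [axDistrib, Sentence.Realize, Formula.Realize, BoundedFormula.realize_all,
    BoundedFormula.realize_imp, BoundedFormula.realize_inf, realize_isMeet, realize_isJoin,
    realize_sub', and_imp]
  simp [Fin.snoc]

theorem models_axAt : M ⊨ axAt ↔ ∀ x : M, atE x ↔
    x ≠ botE M ∧ ∀ z, subE z x → z = botE M ∨ z = x := by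
  simp [axAt, Sentence.Realize, Formula.Realize, Fin.snoc]

theorem models_axAtomic :
    M ⊨ axAtomic ↔ ∀ x : M, x ≠ botE M → ∃ a, atE a ∧ subE a x := by
  simp [axAtomic, Sentence.Realize, Formula.Realize, Fin.snoc]

theorem models_axIrrefl : M ⊨ axIrrefl ↔ ∀ x : M, atE x → ¬ exleE x x := by
  simp [axIrrefl, Sentence.Realize, Formula.Realize, Fin.snoc]

theorem models_axTransAt : M ⊨ axTransAt ↔ ∀ x y z : M, atE x → atE y → atE z →
    exleE x y → exleE y z → exleE x z := by
  simp [axTransAt, Sentence.Realize, Formula.Realize, Fin.snoc]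

theorem models_axTrich : M ⊨ axTrich ↔ ∀ x y : M, atE x → atE y →
    (exleE x y ∨ x = y) ∨ exleE y x := by
  simp [axTrich, Sentence.Realize, Formula.Realize, Fin.snoc]

theorem models_axExleDef : M ⊨ axExleDef ↔ ∀ x y : M, exleE x y ↔
    ∃ a b, (((atE a ∧ atE b) ∧ subE a x) ∧ subE b y) ∧ exleE a b := by
  simp [axExleDef, Sentence.Realize, Formula.Realize, Fin.snoc]

theorem models_compAx (η : BF (n + 1)) : M ⊨ compAx η ↔ ∀ xs : Fin n → M, ∃ X, ∀ x,
    atE x → (subE x X ↔ η.Realize default (Fin.snoc xs x)) := by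
  rw [compAx, Sentence.Realize, BoundedFormula.realize_alls]
  simp only [BoundedFormula.realize_ex, BoundedFormula.realize_all, BoundedFormula.realize_imp,
    BoundedFormula.realize_iff, realize_at', realize_sub', Fin.snoc_last, Fin.snoc_castSucc]
  refine forall_congr' fun xs => exists_congr fun X => forall_congr' fun x =>
    imp_congr_right fun _ => iff_congr Iff.rfl ?_
  rw [BoundedFormula.realize_liftAt_one (Nat.le_succ n), iff_iff_eq]
  congr 1
  funext i
  refine Fin.lastCases ?_ (fun i => ?_) i
  · simp [Fin.succ_last]
  · simp

theorem models_axLeastAtom : M ⊨ axLeastAtom ↔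
    ((∃ x : M, atE x) → ∃ x : M, atE x ∧ ∀ z, atE z → ¬ exleE z x) := by
  simp [axLeastAtom, Sentence.Realize, Formula.Realize, Fin.snoc]

theorem models_axGreatestAtom : M ⊨ axGreatestAtom ↔
    ((∃ x : M, atE x) → ∃ x : M, atE x ∧ ∀ z, atE z → ¬ exleE x z) := by
  simp [axGreatestAtom, Sentence.Realize, Formula.Realize, Fin.snoc]

theorem models_axSucc : M ⊨ axSucc ↔ ∀ x : M, atE x → (∃ y, atE y ∧ exleE x y) →
    ∃ y, ((atE x ∧ atE y) ∧ exleE x y) ∧ ∀ z, atE z → exleE x z → z = y ∨ exleE y z := by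
  simp [axSucc, Sentence.Realize, Formula.Realize, Fin.snoc]

theorem models_axPred : M ⊨ axPred ↔ ∀ x : M, atE x → (∃ y, atE y ∧ exleE y x) →
    ∃ y, ((atE y ∧ atE x) ∧ exleE y x) ∧ ∀ z, atE z → exleE y z → z = x ∨ exleE x z := by
  simp [axPred, Sentence.Realize, Formula.Realize, Fin.snoc]

theorem models_axLeastIn : M ⊨ axLeastIn ↔ ∀ x : M, x ≠ botE M →
    ∃ a, (atE a ∧ subE a x) ∧ ∀ z, atE z → subE z x → ¬ exleE z a := by
  simp [axLeastIn, Sentence.Realize, Formula.Realize, Fin.snoc]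

end Semantics

/-! ### Soundness: finite orders satisfy `TMSOFin` -/

section Soundness

variable {α : Type*} [LinearOrder α]

theorem subE_set {A B : Set α} : subE A B ↔ A ⊆ B := Iff.rfl

theorem atE_set {A : Set α} : atE A ↔ ∃ a, A = {a} := Iff.rfl

theorem exleE_set {A B : Set α} : exleE A B ↔ ∃ a ∈ A, ∃ b ∈ B, a < b := Iff.rfl

theorem botE_set : botE (Set α) = ∅ := rfl

theorem exleE_singleton {a b : α} : exleE ({a} : Set α) {b} ↔ a < b := by
  simp [exleE_set]

theorem models_Tbase (α : Type*) [LinearOrder α] : Set α ⊨ Tbase := by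
  rw [Theory.model_iff]
  rintro φ (h | h)
  · simp only [Set.mem_insert_iff, Set.mem_singleton_iff] at h
    rcases h with rfl | rfl | rfl | rfl | rfl | rfl | rfl | rfl | rfl | rfl | rfl | rfl | rfl |
      rfl | rfl
    · exact models_axRefl.2 fun x => subset_rfl
    · exact models_axAntisymm.2 fun x y => Set.Subset.antisymm
    · exact models_axTrans.2 fun x y z => Set.Subset.trans
    · exact models_axBotLe.2 fun x => Set.empty_subset x
    · exact models_axTop.2 ⟨Set.univ, Set.subset_univ⟩
    · exact models_axMeet.2 fun x y => ⟨x ∩ y, ⟨Set.inter_subset_left, Set.inter_subset_right⟩,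
        fun z => Set.subset_inter⟩
    · exact models_axJoin.2 fun x y => ⟨x ∪ y, ⟨Set.subset_union_left, Set.subset_union_right⟩,
        fun z => Set.union_subset⟩
    · refine models_axCompl.2 fun x => ⟨xᶜ, fun z h₁ h₂ => ?_, fun z h₁ h₂ w => ?_⟩
      · exact Set.subset_empty_iff.1 fun a ha => h₂ ha (h₁ ha)
      · exact fun a _ => (em (a ∈ x)).elim (fun h => h₁ h) fun h => h₂ h
    · refine models_axDistrib.2 fun a b c d e f g h hd he hf hg hh => ?_
      have h₁ : f ⊆ b ∪ c := hf.2 _ Set.subset_union_left Set.subset_union_right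
      have h₂ : a ∩ b ⊆ d := hd.2 _ Set.inter_subset_left Set.inter_subset_right
      have h₃ : a ∩ c ⊆ e := he.2 _ Set.inter_subset_left Set.inter_subset_right
      intro x hx
      rcases h₁ (hg.1.2 hx) with hb | hc
      · exact hh.1.1 (h₂ ⟨hg.1.1 hx, hb⟩)
      · exact hh.1.2 (h₃ ⟨hg.1.1 hx, hc⟩)
    · refine models_axAt.2 fun x => ?_
      simp only [atE_set, subE_set, botE_set]
      constructor
      · rintro ⟨a, rfl⟩
        exact ⟨Set.singleton_ne_empty a, fun z => Set.subset_singleton_iff_eq.1⟩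
      · rintro ⟨h₁, h₂⟩
        obtain ⟨a, ha⟩ := Set.nonempty_iff_ne_empty.2 h₁
        refine ⟨a, ?_⟩
        rcases h₂ {a} (Set.singleton_subset_iff.2 ha) with h | h
        · exact absurd h (Set.singleton_ne_empty a)
        · exact h.symm
    · refine models_axAtomic.2 fun x hx => ?_
      obtain ⟨a, ha⟩ := Set.nonempty_iff_ne_empty.2 hx
      exact ⟨{a}, ⟨a, rfl⟩, Set.singleton_subset_iff.2 ha⟩
    · refine models_axIrrefl.2 ?_
      rintro _ ⟨a, rfl⟩
      simp [exleE_singleton]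
    · refine models_axTransAt.2 ?_
      rintro _ _ _ ⟨a, rfl⟩ ⟨b, rfl⟩ ⟨c, rfl⟩
      simpa only [exleE_singleton] using lt_trans
    · refine models_axTrich.2 ?_
      rintro _ _ ⟨a, rfl⟩ ⟨b, rfl⟩
      simpa only [exleE_singleton, Set.singleton_eq_singleton_iff, or_assoc] using
        lt_trichotomy a b
    · refine models_axExleDef.2 fun x y => ⟨?_, ?_⟩
      · rintro ⟨a, ha, b, hb, hab⟩
        exact ⟨{a}, {b}, ⟨⟨⟨⟨a, rfl⟩, b, rfl⟩, Set.singleton_subset_iff.2 ha⟩,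
          Set.singleton_subset_iff.2 hb⟩, exleE_singleton.2 hab⟩
      · rintro ⟨_, _, ⟨⟨⟨⟨a, rfl⟩, b, rfl⟩, ha⟩, hb⟩, hab⟩
        exact ⟨a, Set.singleton_subset_iff.1 ha, b, Set.singleton_subset_iff.1 hb,
          exleE_singleton.1 hab⟩
  · obtain ⟨n, η, rfl⟩ := Set.mem_iUnion.1 h
    refine (models_compAx η).2 fun xs =>
      ⟨{a | η.Realize default (Fin.snoc xs ({a} : Set α))}, ?_⟩
    rintro _ ⟨a, rfl⟩
    rw [subE_set, Set.singleton_subset_iff]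
    exact iff_of_eq (congrArg (fun v => η.Realize v _) (Subsingleton.elim _ _))

theorem models_TMSOFin_MSOn (n : ℕ) : MSOn n ⊨ TMSOFin := by
  refine (models_Tbase (Fin n)).union ?_
  rw [Theory.model_iff]
  intro φ h
  simp only [Set.mem_insert_iff, Set.mem_singleton_iff] at h
  rcases h with rfl | rfl | rfl | rfl | rfl
  · rw [models_axLeastAtom]
    rintro ⟨_, a, rfl⟩
    obtain ⟨b, hb⟩ := (Set.univ : Set (Fin n)).toFinite.exists_minimal ⟨a, trivial⟩
    refine ⟨{b}, ⟨b, rfl⟩, ?_⟩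
    rintro _ ⟨c, rfl⟩ h
    exact hb.not_lt trivial (exleE_singleton.1 h)
  · rw [models_axGreatestAtom]
    rintro ⟨_, a, rfl⟩
    obtain ⟨b, hb⟩ := (Set.univ : Set (Fin n)).toFinite.exists_maximal ⟨a, trivial⟩
    refine ⟨{b}, ⟨b, rfl⟩, ?_⟩
    rintro _ ⟨c, rfl⟩ h
    exact hb.not_gt trivial (exleE_singleton.1 h)
  · rw [models_axSucc]
    rintro _ ⟨a, rfl⟩ ⟨_, ⟨b, rfl⟩, hab⟩
    obtain ⟨c, hc⟩ := (Set.Ioi a).toFinite.exists_minimal ⟨b, exleE_singleton.1 hab⟩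
    refine ⟨{c}, ⟨⟨⟨a, rfl⟩, c, rfl⟩, exleE_singleton.2 hc.prop⟩, ?_⟩
    rintro _ ⟨d, rfl⟩ h
    rw [exleE_singleton] at h
    rw [exleE_singleton, Set.singleton_eq_singleton_iff, eq_comm]
    exact (not_lt.1 (hc.not_lt h)).eq_or_lt
  · rw [models_axPred]
    rintro _ ⟨a, rfl⟩ ⟨_, ⟨b, rfl⟩, hab⟩
    obtain ⟨c, hc⟩ := (Set.Iio a).toFinite.exists_maximal ⟨b, exleE_singleton.1 hab⟩
    refine ⟨{c}, ⟨⟨⟨c, rfl⟩, a, rfl⟩, exleE_singleton.2 hc.prop⟩, ?_⟩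
    rintro _ ⟨d, rfl⟩ h
    rw [exleE_singleton] at h
    rw [exleE_singleton, Set.singleton_eq_singleton_iff, eq_comm]
    exact (not_lt.1 fun hd => hc.not_gt hd h).eq_or_lt
  · rw [models_axLeastIn]
    intro x hx
    obtain ⟨c, hc⟩ := x.toFinite.exists_minimal (Set.nonempty_iff_ne_empty.2 hx)
    refine ⟨{c}, ⟨⟨c, rfl⟩, Set.singleton_subset_iff.2 hc.prop⟩, ?_⟩
    rintro _ ⟨d, rfl⟩ hd h
    exact hc.not_lt (Set.singleton_subset_iff.1 hd) (exleE_singleton.1 h)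

end Soundness

/-! ### Consequences of the axioms -/

section Consequences

/-- The elements of `M` behave like sets of atoms: inclusion, `⊥` and `≤ᴱ` are determined by the
atoms below the elements involved. -/
structure IsSetLike (M : Type*) [Lmso.Structure M] : Prop where
  subE_iff : ∀ x y : M, subE x y ↔ ∀ a, atE a → subE a x → subE a y
  antisymm : ∀ x y : M, subE x y → subE y x → x = y
  not_subE_bot : ∀ a : M, atE a → ¬ subE a (botE M)
  subE_atom : ∀ a b : M, atE a → atE b → (subE b a ↔ b = a)
  exleE_iff : ∀ x y : M, exleE x y ↔ ∃ a, atE a ∧ ∃ b, atE b ∧ subE a x ∧ subE b y ∧ exleE a b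

variable {M : Type*} [Lmso.Structure M]

theorem IsSetLike.atE_iff (h : IsSetLike M) (x : M) :
    atE x ↔ ∃ a, atE a ∧ ∀ b, atE b → (subE b x ↔ b = a) := by
  constructor
  · exact fun hx => ⟨x, hx, fun b hb => h.subE_atom x b hx hb⟩
  · rintro ⟨a, ha, hx⟩
    have : x = a := by
      apply h.antisymm
      · exact (h.subE_iff _ _).2 fun b hb hbx => (h.subE_atom a b ha hb).2 ((hx b hb).1 hbx)
      · exact (h.subE_iff _ _).2 fun b hb hba => (hx b hb).2 ((h.subE_atom a b ha hb).1 hba)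
    exact this ▸ ha

theorem isSetLike_of_models (M : Type*) [Lmso.Structure M] [M ⊨ Tbase] : IsSetLike M := by
  have ax {φ : Lmso.Sentence} (h : φ ∈ Tbase) : M ⊨ φ := Tbase.realize_sentence_of_mem h
  have hrefl := models_axRefl.1 (ax (by simp [Tbase]))
  have hanti := models_axAntisymm.1 (ax (by simp [Tbase]))
  have htrans := models_axTrans.1 (ax (by simp [Tbase]))
  have hbot := models_axBotLe.1 (ax (by simp [Tbase]))
  have hmeet := models_axMeet.1 (ax (by simp [Tbase]))
  have hjoin := models_axJoin.1 (ax (by simp [Tbase]))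
  have hcompl := models_axCompl.1 (ax (by simp [Tbase]))
  have hdistrib := models_axDistrib.1 (ax (by simp [Tbase]))
  have hat := models_axAt.1 (ax (by simp [Tbase]))
  have hatomic := models_axAtomic.1 (ax (by simp [Tbase]))
  have hexle := models_axExleDef.1 (ax (by simp [Tbase]))
  have hnb : ∀ a : M, atE a → ¬ subE a (botE M) := fun a ha h =>
    ((hat a).1 ha).1 (hanti _ _ h (hbot a))
  refine ⟨fun x y => ⟨fun h a _ hax => htrans _ _ _ hax h, fun h => ?_⟩, hanti, hnb,
    fun a b ha hb => ⟨fun h => ?_, ?_⟩, fun x y => (hexle x y).trans ?_⟩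
  · obtain ⟨y', hy₁, hy₂⟩ := hcompl y
    obtain ⟨d, hd⟩ := hmeet x y
    obtain ⟨e, he⟩ := hmeet x y'
    obtain ⟨f, hf⟩ := hjoin y y'
    obtain ⟨g, hg⟩ := hmeet x f
    obtain ⟨k, hk⟩ := hjoin d e
    have hgk := hdistrib x y y' d e f g k hd he hf hg hk
    have hxg : subE x g := hg.2 x (hrefl x) (hy₂ f hf.1.1 hf.1.2 x)
    have he₀ : e = botE M := by
      by_contra hne
      obtain ⟨a, ha, hae⟩ := hatomic e hne
      have := hy₁ a (h a ha (htrans _ _ _ hae he.1.1)) (htrans _ _ _ hae he.1.2)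
      exact ((hat a).1 ha).1 this
    exact htrans _ _ _ (htrans _ _ _ hxg hgk) (hk.2 y hd.1.2 (he₀ ▸ hbot y))
  · exact (((hat a).1 ha).2 b h).resolve_left ((hat b).1 hb).1
  · rintro rfl
    exact hrefl b
  · constructor
    · rintro ⟨a, b, ⟨⟨⟨ha, hb⟩, hax⟩, hby⟩, hab⟩
      exact ⟨a, ha, b, hb, hax, hby, hab⟩
    · rintro ⟨a, ha, b, hb, hax, hby, hab⟩
      exact ⟨a, b, ⟨⟨⟨ha, hb⟩, hax⟩, hby⟩, hab⟩

theorem exists_comprehension [M ⊨ Tbase] {n : ℕ} (η : BF (n + 1)) (xs : Fin n → M) :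
    ∃ X : M, ∀ x, atE x → (subE x X ↔ η.Realize default (Fin.snoc xs x)) :=
  (models_compAx η).1
    (Tbase.realize_sentence_of_mem (Or.inr (Set.mem_iUnion.2 ⟨n, η, rfl⟩))) xs

/-- An element can be modified at a given atom. -/
def IsModifiableAt (a : M) : Prop :=
  ∀ (X : M) (p : Prop), ∃ Y, (subE a Y ↔ p) ∧ ∀ b, atE b → b ≠ a → (subE b Y ↔ subE b X)

theorem isModifiableAt_of_models [M ⊨ Tbase] {a : M} (ha : atE a) : IsModifiableAt a := by
  intro X p
  by_cases hp : p
  · obtain ⟨Y, hY⟩ := exists_comprehension (sub' (2 : Fin 3) 0 ⊔ eq' 2 1) ![X, a]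
    simp only [BoundedFormula.realize_sup, realize_sub', realize_eq'] at hY
    refine ⟨Y, ?_, fun b hb hne => (hY b hb).trans ?_⟩
    · simp [hp, hY a ha, Fin.snoc]
    · simp [hne, Fin.snoc]
  · obtain ⟨Y, hY⟩ := exists_comprehension (sub' (2 : Fin 3) 0 ⊓ ∼(eq' 2 1)) ![X, a]
    simp only [BoundedFormula.realize_inf, BoundedFormula.realize_not, realize_sub',
      realize_eq'] at hY
    refine ⟨Y, ?_, fun b hb hne => (hY b hb).trans ?_⟩
    · simp [hp, hY a ha, Fin.snoc]
    · simp [hne, Fin.snoc]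

end Consequences

/-! ### Types of initial segments -/

section Types

/-- The indices of the atomic facts about `m` elements; `none` stands for `⊥`. -/
abbrev FactIdx (m : ℕ) : Type :=
  Option (Fin m) ⊕ (Option (Fin m) × Option (Fin m)) ⊕ (Option (Fin m) × Option (Fin m))

/-- The finite set of possible rank `k` types of `m` elements. -/
def RankType : ℕ → ℕ → Type
  | 0, m => Set (FactIdx m)
  | k + 1, m => Set (RankType k (m + 1))

instance RankType.finite : ∀ k m, Finite (RankType k m)
  | 0, m => inferInstanceAs (Finite (Set (FactIdx m)))
  | k + 1, m =>
    have := RankType.finite k (m + 1)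
    inferInstanceAs (Finite (Set (RankType k (m + 1))))

variable {M N : Type*} [Lmso.Structure M] [Lmso.Structure N]

/-- `a` lies below the element named by an optional index, where `none` names `⊥`. -/
def Below {m : ℕ} (X : Fin m → M) (a : M) : Option (Fin m) → Prop
  | none => False
  | some i => subE a (X i)

/-- The atomic facts about the traces of the elements `X` on a set `P` of atoms. -/
def Fact (P : Set M) {m : ℕ} (X : Fin m → M) : FactIdx m → Prop
  | .inl o => ∃ a ∈ P, ∀ b ∈ P, Below X b o ↔ b = a
  | .inr (.inl (o, o')) => ∀ a ∈ P, Below X a o → Below X a o'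
  | .inr (.inr (o, o')) => ∃ a ∈ P, ∃ b ∈ P, Below X a o ∧ Below X b o' ∧ exleE a b

/-- The rank `k` type of the traces of the elements `X` on a set `P` of atoms. -/
def rankType (P : Set M) : ∀ (k : ℕ) {m : ℕ}, (Fin m → M) → RankType k m
  | 0, _, X => {i | Fact P X i}
  | k + 1, _, X => Set.range fun Y : M => rankType P k (Fin.snoc X Y : Fin (_ + 1) → M)

theorem rankType_zero_eq_iff {P : Set M} {Q : Set N} {m : ℕ} {X : Fin m → M} {Y : Fin m → N} :
    rankType P 0 X = rankType Q 0 Y ↔ ∀ i, Fact P X i ↔ Fact Q Y i :=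
  Set.ext_iff

theorem rankType_succ_eq_iff {P : Set M} {Q : Set N} {k m : ℕ} {X : Fin m → M} {Y : Fin m → N} :
    rankType P (k + 1) X = rankType Q (k + 1) Y ↔
      (∀ A : M, ∃ B : N, rankType P k (Fin.snoc X A : Fin (m + 1) → M) =
        rankType Q k (Fin.snoc Y B : Fin (m + 1) → N)) ∧
      ∀ B : N, ∃ A : M, rankType P k (Fin.snoc X A : Fin (m + 1) → M) =
        rankType Q k (Fin.snoc Y B : Fin (m + 1) → N) := by
  refine Set.Subset.antisymm_iff.trans (and_congr ?_ ?_)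
  · refine Set.range_subset_iff.trans (forall_congr' fun A => ?_)
    exact exists_congr fun B => eq_comm
  · exact Set.range_subset_iff

theorem rankType_empty (k : ℕ) [Nonempty M] [Nonempty N] {m : ℕ} (X : Fin m → M)
    (Y : Fin m → N) : rankType ∅ k X = rankType ∅ k Y := by
  induction k generalizing m with
  | zero =>
    rw [rankType_zero_eq_iff]
    rintro (o | ⟨o, o'⟩ | ⟨o, o'⟩) <;> simp [Fact]
  | succ k ih =>
    rw [rankType_succ_eq_iff]
    exact ⟨fun A => ⟨Classical.arbitrary N, ih _ _⟩, fun B => ⟨Classical.arbitrary M, ih _ _⟩⟩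

theorem below_congr {P : Set M} {m : ℕ} {X Y : Fin m → M}
    (h : ∀ a ∈ P, ∀ i, subE a (X i) ↔ subE a (Y i)) (a : M) (ha : a ∈ P) (o : Option (Fin m)) :
    Below X a o ↔ Below Y a o := by
  cases o with
  | none => exact Iff.rfl
  | some i => exact h a ha i

theorem rankType_congr {P : Set M} (k : ℕ) {m : ℕ} {X Y : Fin m → M}
    (h : ∀ a ∈ P, ∀ i, subE a (X i) ↔ subE a (Y i)) : rankType P k X = rankType P k Y := by
  induction k generalizing m with
  | zero =>
    have hb := below_congr h
    rw [rankType_zero_eq_iff]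
    rintro (o | ⟨o, o'⟩ | ⟨o, o'⟩)
    · exact exists_congr fun a => and_congr_right fun _ => forall₂_congr fun b hbP =>
        iff_congr (hb b hbP o) Iff.rfl
    · exact forall₂_congr fun a ha => imp_congr (hb a ha o) (hb a ha o')
    · exact exists_congr fun a => and_congr_right fun ha => exists_congr fun b =>
        and_congr_right fun hbP => and_congr (hb a ha o) (and_congr_left' (hb b hbP o'))
  | succ k ih =>
    have (A : M) : rankType P k (Fin.snoc X A : Fin (m + 1) → M) =
        rankType P k (Fin.snoc Y A : Fin (m + 1) → M) := by
      refine ih fun a ha i => ?_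
      refine Fin.lastCases ?_ (fun i => ?_) i
      · simp
      · simpa using h a ha i
    exact rankType_succ_eq_iff.2 ⟨fun A => ⟨A, this A⟩, fun A => ⟨A, this A⟩⟩

/-- `a` is an atom lying strictly above all atoms in `P`, at which elements can be modified. -/
structure IsNext (P : Set M) (a : M) : Prop where
  atE_of_mem : ∀ b ∈ P, atE b
  atE : atE a
  lt : ∀ b ∈ P, exleE b a
  not_lt : ∀ b ∈ P, ¬ exleE a b
  irrefl : ¬ exleE a a
  isModifiableAt : IsModifiableAt a

namespace IsNext

variable {P : Set M} {Q : Set N} {a : M} {b : N}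

theorem ne (h : IsNext P a) {c : M} (hc : c ∈ P) : c ≠ a := by
  rintro rfl
  exact h.irrefl (h.lt c hc)

theorem fact_singleton_insert (h : IsNext P a) {m : ℕ} (X : Fin m → M) (o : Option (Fin m)) :
    Fact (insert a P) X (.inl o) ↔
      (Fact P X (.inl o) ∧ ¬ Below X a o) ∨
        (Fact P X (.inr (.inl (o, none))) ∧ Below X a o) := by
  simp only [Fact, Set.mem_insert_iff, exists_eq_or_imp, forall_eq_or_imp]
  have h₁ := fun c hc => h.ne (c := c) hc
  constructor
  · rintro (⟨h₂, h₃⟩ | ⟨c, hc, h₂, h₃⟩)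
    · exact Or.inr ⟨fun c hc hco => h₁ c hc ((h₃ c hc).1 hco), h₂.2 trivial⟩
    · exact Or.inl ⟨⟨c, hc, h₃⟩, fun hao => h₁ c hc (h₂.1 hao).symm⟩
  · rintro (⟨⟨c, hc, h₃⟩, h₂⟩ | ⟨h₂, h₃⟩)
    · exact Or.inr ⟨c, hc, iff_of_false h₂ (h₁ c hc).symm, h₃⟩
    · exact Or.inl ⟨iff_of_true h₃ trivial, fun c hc => iff_of_false (h₂ c hc) (h₁ c hc)⟩

theorem fact_sub_insert (X : Fin m → M) (o o' : Option (Fin m)) :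
    Fact (insert a P) X (.inr (.inl (o, o'))) ↔
      (Below X a o → Below X a o') ∧ Fact P X (.inr (.inl (o, o'))) := by
  simp only [Fact, Set.mem_insert_iff, forall_eq_or_imp]

theorem fact_exle_insert (h : IsNext P a) {m : ℕ} (X : Fin m → M) (o o' : Option (Fin m)) :
    Fact (insert a P) X (.inr (.inr (o, o'))) ↔
      Fact P X (.inr (.inr (o, o'))) ∨
        (¬ Fact P X (.inr (.inl (o, none))) ∧ Below X a o') := by
  simp only [Fact, Set.mem_insert_iff, exists_eq_or_imp]
  constructor
  · rintro ((⟨-, -, h₂⟩ | ⟨c, hc, -, -, h₂⟩) | ⟨c, hc, (⟨h₂, h₃, -⟩ | ⟨d, hd, h₂⟩)⟩)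
    · exact absurd h₂ h.irrefl
    · exact absurd h₂ (h.not_lt c hc)
    · exact Or.inr ⟨fun h₄ => h₄ c hc h₂, h₃⟩
    · exact Or.inl ⟨c, hc, d, hd, h₂⟩
  · rintro (⟨c, hc, d, hd, h₂⟩ | ⟨h₂, h₃⟩)
    · exact Or.inr ⟨c, hc, Or.inr ⟨d, hd, h₂⟩⟩
    · simp only [Below, not_forall] at h₂
      obtain ⟨c, hc, h₄, -⟩ := h₂
      exact Or.inr ⟨c, hc, Or.inl ⟨h₄, h₃, h.lt c hc⟩⟩

theorem exists_extension (hb : IsNext Q b) {k m : ℕ} {t : RankType k (m + 1)}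
    {Y : Fin m → N} {B : N} (hB : t = rankType Q k (Fin.snoc Y B : Fin (m + 1) → N)) (p : Prop) :
    ∃ B' : N, t = rankType Q k (Fin.snoc Y B' : Fin (m + 1) → N) ∧ (subE b B' ↔ p) := by
  obtain ⟨B', h₁, h₂⟩ := hb.isModifiableAt B p
  refine ⟨B', hB.trans (rankType_congr k fun c hc i => ?_), h₁⟩
  refine Fin.lastCases ?_ (fun i => ?_) i
  · simpa using (h₂ c (hb.atE_of_mem c hc) (hb.ne hc)).symm
  · simp

/-- The type on an initial segment extended by one atom is determined by the type on the initial
segment and the traces on the new atom. -/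
theorem rankType_insert (ha : IsNext P a) (hb : IsNext Q b) (k : ℕ) {m : ℕ} {X : Fin m → M}
    {Y : Fin m → N} (h : rankType P k X = rankType Q k Y)
    (hab : ∀ i, subE a (X i) ↔ subE b (Y i)) :
    rankType (insert a P) k X = rankType (insert b Q) k Y := by
  induction k generalizing m with
  | zero =>
    rw [rankType_zero_eq_iff] at h ⊢
    have hB (o : Option (Fin m)) : Below X a o ↔ Below Y b o := by
      cases o with
      | none => exact Iff.rfl
      | some i => exact hab i
    rintro (o | ⟨o, o'⟩ | ⟨o, o'⟩)
    · rw [ha.fact_singleton_insert, hb.fact_singleton_insert, h, h, hB]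
    · rw [fact_sub_insert, fact_sub_insert, h, hB, hB]
    · rw [ha.fact_exle_insert, hb.fact_exle_insert, h, h, hB]
  | succ k ih =>
    have hsnoc {A : M} {B : N} (hAB : subE a A ↔ subE b B) (i : Fin (m + 1)) :
        subE a ((Fin.snoc X A : Fin (m + 1) → M) i) ↔
          subE b ((Fin.snoc Y B : Fin (m + 1) → N) i) := by
      refine Fin.lastCases ?_ (fun i => ?_) i
      · simpa using hAB
      · simpa using hab i
    rw [rankType_succ_eq_iff] at h ⊢
    constructor
    · intro A
      obtain ⟨B, hB⟩ := h.1 A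
      obtain ⟨B', h₁, h₂⟩ := hb.exists_extension hB (subE a A)
      exact ⟨B', ih h₁ (hsnoc h₂.symm)⟩
    · intro B
      obtain ⟨A, hA⟩ := h.2 B
      obtain ⟨A', h₁, h₂⟩ := ha.exists_extension hA.symm (subE b B)
      exact ⟨A', ih h₁.symm (hsnoc h₂)⟩

end IsNext

end Types

/-! ### Types determine the truth of formulas -/

section Realize

variable {M N : Type*} [Lmso.Structure M] [Lmso.Structure N] {m : ℕ}

/-- The index of the element denoted by a term. -/
def termIdx : Lmso.Term (Empty ⊕ Fin m) → Option (Fin m)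
  | .var (.inl e) => e.elim
  | .var (.inr i) => some i
  | .func _ _ => none

theorem realize_eq_elim_termIdx (t : Lmso.Term (Empty ⊕ Fin m)) (v : Empty → M) (X : Fin m → M) :
    t.realize (Sum.elim v X) = (termIdx t).elim (botE M) X := by
  match t with
  | .var (.inl e) => exact e.elim
  | .var (.inr i) => rfl
  | .func (l := 0) f ts =>
    exact congrArg (Structure.funMap f) (Subsingleton.elim (α := Fin 0 → M) _ _)
  | .func (l := _ + 1) f ts => exact Empty.elim f

namespace IsSetLike

theorem below_iff (h : IsSetLike M) {a : M} (ha : atE a) (X : Fin m → M) (o : Option (Fin m)) :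
    Below X a o ↔ subE a (o.elim (botE M) X) := by
  cases o with
  | none => exact iff_of_false id (h.not_subE_bot a ha)
  | some i => exact Iff.rfl

theorem atE_elim_iff (h : IsSetLike M) (X : Fin m → M) (o : Option (Fin m)) :
    atE (o.elim (botE M) X) ↔ Fact {a | atE a} X (.inl o) := by
  rw [h.atE_iff]
  exact exists_congr fun a => and_congr_right fun _ => forall₂_congr fun b hb =>
    iff_congr (h.below_iff hb X o).symm Iff.rfl

theorem subE_elim_iff (h : IsSetLike M) (X : Fin m → M) (o o' : Option (Fin m)) :
    subE (o.elim (botE M) X) (o'.elim (botE M) X) ↔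
      Fact {a | atE a} X (.inr (.inl (o, o'))) := by
  rw [h.subE_iff]
  exact forall₂_congr fun a ha =>
    imp_congr (h.below_iff ha X o).symm (h.below_iff ha X o').symm

theorem exleE_elim_iff (h : IsSetLike M) (X : Fin m → M) (o o' : Option (Fin m)) :
    exleE (o.elim (botE M) X) (o'.elim (botE M) X) ↔
      Fact {a | atE a} X (.inr (.inr (o, o'))) := by
  rw [h.exleE_iff]
  exact exists_congr fun a => and_congr_right fun ha => exists_congr fun b =>
    and_congr_right fun hb => and_congr (h.below_iff ha X o).symm
      (and_congr_left' (h.below_iff hb X o').symm)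

theorem elim_eq_iff (h : IsSetLike M) (X : Fin m → M) (o o' : Option (Fin m)) :
    o.elim (botE M) X = o'.elim (botE M) X ↔
      Fact {a | atE a} X (.inr (.inl (o, o'))) ∧ Fact {a | atE a} X (.inr (.inl (o', o))) := by
  rw [← h.subE_elim_iff, ← h.subE_elim_iff]
  constructor
  · intro heq
    rw [heq]
    exact ⟨(h.subE_iff _ _).2 fun _ _ => id, (h.subE_iff _ _).2 fun _ _ => id⟩
  · exact fun ⟨h₁, h₂⟩ => h.antisymm _ _ h₁ h₂

end IsSetLike

theorem below_snoc_castSucc (X : Fin m → M) (A a : M) (o : Option (Fin m)) :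
    Below (Fin.snoc X A : Fin (m + 1) → M) a (o.map Fin.castSucc) ↔ Below X a o := by
  cases o <;> simp [Below]

/-- Regard an index of an atomic fact about `m` elements as one about `m + 1` elements. -/
def FactIdx.castSucc : FactIdx m → FactIdx (m + 1) :=
  Sum.map (Option.map Fin.castSucc) (Sum.map
    (Prod.map (Option.map Fin.castSucc) (Option.map Fin.castSucc))
    (Prod.map (Option.map Fin.castSucc) (Option.map Fin.castSucc)))

theorem fact_snoc_castSucc (P : Set M) (X : Fin m → M) (A : M) (i : FactIdx m) :
    Fact P (Fin.snoc X A : Fin (m + 1) → M) i.castSucc ↔ Fact P X i := by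
  rcases i with o | ⟨o, o'⟩ | ⟨o, o'⟩ <;> simp [FactIdx.castSucc, Fact, below_snoc_castSucc]

theorem fact_iff_of_rankType_eq [Nonempty M] {P : Set M} {Q : Set N} {k m : ℕ} {X : Fin m → M}
    {Y : Fin m → N} (h : rankType P k X = rankType Q k Y) (i : FactIdx m) :
    Fact P X i ↔ Fact Q Y i := by
  induction k generalizing m with
  | zero => exact rankType_zero_eq_iff.1 h i
  | succ k ih =>
    obtain ⟨B, hB⟩ := (rankType_succ_eq_iff.1 h).1 (Classical.arbitrary M)
    rw [← fact_snoc_castSucc P X (Classical.arbitrary M), ← fact_snoc_castSucc Q Y B]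
    exact ih hB _

theorem relMap_one (f : Fin 1 → M) (r : Lmso.Relations 1) :
    Structure.RelMap r f ↔ atE (f 0) := by
  have : f = ![f 0] := by
    ext i
    fin_cases i
    rfl
  rw [this]
  rfl

theorem relMap_two (f : Fin 2 → M) (r : Lmso.Relations 2) :
    Structure.RelMap r f ↔ bif (r : Bool) then subE (f 0) (f 1) else exleE (f 0) (f 1) := by
  have : f = ![f 0, f 1] := by
    ext i
    fin_cases i <;> rfl
  rw [this]
  cases (r : Bool) <;> exact Iff.rfl

theorem realize_iff_of_rankType_eq (hM : IsSetLike M) (hN : IsSetLike N) {k : ℕ}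
    {X : Fin m → M} {Y : Fin m → N}
    (h : rankType {a | atE a} k X = rankType {a | atE a} k Y) (φ : BF m) (hφ : qr φ ≤ k)
    (v : Empty → M) (w : Empty → N) : φ.Realize v X ↔ φ.Realize w Y := by
  have : Nonempty M := ⟨botE M⟩
  induction φ generalizing k with
  | falsum => exact Iff.rfl
  | equal t₁ t₂ =>
    change t₁.realize _ = t₂.realize _ ↔ t₁.realize _ = t₂.realize _
    simp only [realize_eq_elim_termIdx]
    rw [hM.elim_eq_iff, hN.elim_eq_iff, fact_iff_of_rankType_eq h, fact_iff_of_rankType_eq h]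
  | @rel _ l R ts =>
    change Structure.RelMap R (fun i => (ts i).realize _) ↔
      Structure.RelMap R (fun i => (ts i).realize _)
    simp only [realize_eq_elim_termIdx]
    match l, R with
    | 0, R => exact Empty.elim R
    | 1, R =>
      rw [relMap_one, relMap_one, hM.atE_elim_iff, hN.atE_elim_iff, fact_iff_of_rankType_eq h]
    | 2, R =>
      rw [relMap_two, relMap_two]
      cases (R : Bool)
      · simp only [cond_false]
        rw [hM.exleE_elim_iff, hN.exleE_elim_iff, fact_iff_of_rankType_eq h]
      · simp only [cond_true]
        rw [hM.subE_elim_iff, hN.subE_elim_iff, fact_iff_of_rankType_eq h]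
    | _ + 3, R => exact Empty.elim R
  | imp f g ihf ihg =>
    exact imp_congr (ihf h ((le_max_left _ _).trans hφ)) (ihg h ((le_max_right _ _).trans hφ))
  | all f ih =>
    obtain ⟨k, rfl⟩ : ∃ k', k = k' + 1 := ⟨k - 1, by simp only [qr] at hφ; omega⟩
    have hf : qr f ≤ k := Nat.le_of_succ_le_succ hφ
    obtain ⟨h₁, h₂⟩ := rankType_succ_eq_iff.1 h
    simp only [BoundedFormula.realize_all]
    constructor
    · intro H B
      obtain ⟨A, hA⟩ := h₂ B
      exact (ih hA hf).1 (H A)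
    · intro H A
      obtain ⟨B, hB⟩ := h₁ A
      exact (ih hB hf).2 (H B)

end Realize

/-! ### Definability of types -/

section Definability

variable {M : Type*} [Lmso.Structure M] {n m : ℕ}

/-- The atoms that are at most `a`. -/
def seg (a : M) : Set M := {x | atE x ∧ ¬ exleE a x}

/-- A relation on `M` is definable if it is defined by a formula without parameters. -/
def IsDef (R : (Fin n → M) → Prop) : Prop :=
  ∃ η : BF n, ∀ v xs, η.Realize v xs ↔ R xs

theorem IsDef.not {R : (Fin n → M) → Prop} (h : IsDef R) : IsDef fun xs => ¬ R xs := by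
  obtain ⟨η, hη⟩ := h
  exact ⟨∼η, fun v xs => by simp [hη]⟩

theorem IsDef.forall {ι : Type} [Finite ι] {R : ι → (Fin n → M) → Prop} (h : ∀ i, IsDef (R i)) :
    IsDef fun xs => ∀ i, R i xs := by
  choose η hη using h
  exact ⟨BoundedFormula.iInf η, fun v xs => by simp [BoundedFormula.realize_iInf, hη]⟩

theorem IsDef.exists_snoc {R : (Fin (n + 1) → M) → Prop} (h : IsDef R) :
    IsDef fun xs : Fin n → M => ∃ A : M, R (Fin.snoc xs A) := by
  obtain ⟨η, hη⟩ := h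
  exact ⟨∃' η, fun v xs => by simp [hη]⟩

theorem IsDef.setOf_eq {ι : Type} [Finite ι] {R : ι → (Fin n → M) → Prop}
    (h : ∀ i, IsDef (R i)) (t : Set ι) : IsDef fun xs => {i | R i xs} = t := by
  have h₁ (i : ι) : IsDef fun xs => R i xs ↔ i ∈ t := by
    by_cases hi : i ∈ t
    · simpa [hi] using h i
    · simpa [hi] using (h i).not
  have h₂ : (fun xs => {i | R i xs} = t) = fun xs => ∀ i, R i xs ↔ i ∈ t :=
    funext fun xs => propext Set.ext_iff
  exact h₂ ▸ IsDef.forall h₁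

/-- The formula saying that the element `x` lies below the element named by an optional index. -/
def belowF (f : Fin m → Fin n) (x : Fin n) : Option (Fin m) → BF n
  | none => ⊥
  | some i => sub' x (f i)

@[simp]
theorem realize_belowF (f : Fin m → Fin n) (x : Fin n) (o : Option (Fin m)) {v : Empty → M}
    {xs : Fin n → M} : (belowF f x o).Realize v xs ↔ Below (fun i => xs (f i)) (xs x) o := by
  cases o <;> simp [belowF, Below]

theorem isDef_fact (i : FactIdx m) : IsDef fun xs : Fin (m + 1) → M =>
    Fact (seg (xs 0)) (fun j => xs j.succ) i := by
  rcases i with o | ⟨o, o'⟩ | ⟨o, o'⟩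
  · refine ⟨∃' (at' (Fin.last _) ⊓ ∼(exle' (0 : Fin (m + 1)).castSucc (Fin.last _)) ⊓
      ∀' (at' (Fin.last _) ⟹ ∼(exle' (0 : Fin (m + 1)).castSucc.castSucc (Fin.last _)) ⟹
        (belowF (fun j => j.succ.castSucc.castSucc) (Fin.last _) o ⇔
          eq' (Fin.last _) (Fin.last _).castSucc))), fun v xs => ?_⟩
    simp [-Fin.castSucc_zero, -Fin.castSucc_succ, Fact, seg]
  · refine ⟨∀' (at' (Fin.last _) ⟹ ∼(exle' (0 : Fin (m + 1)).castSucc (Fin.last _)) ⟹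
      belowF (fun j => j.succ.castSucc) (Fin.last _) o ⟹
        belowF (fun j => j.succ.castSucc) (Fin.last _) o'), fun v xs => ?_⟩
    simp [-Fin.castSucc_zero, -Fin.castSucc_succ, Fact, seg]
  · refine ⟨∃' (at' (Fin.last _) ⊓ ∼(exle' (0 : Fin (m + 1)).castSucc (Fin.last _)) ⊓
      ∃' (at' (Fin.last _) ⊓ ∼(exle' (0 : Fin (m + 1)).castSucc.castSucc (Fin.last _)) ⊓
        (belowF (fun j => j.succ.castSucc.castSucc) (Fin.last _).castSucc o ⊓
          (belowF (fun j => j.succ.castSucc.castSucc) (Fin.last _) o' ⊓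
          exle' (Fin.last _).castSucc (Fin.last _))))), fun v xs => ?_⟩
    simp [-Fin.castSucc_zero, -Fin.castSucc_succ, Fact, seg]

theorem isDef_rankType_eq (k : ℕ) (t : RankType k m) : IsDef fun xs : Fin (m + 1) → M =>
    rankType (seg (xs 0)) k (fun j => xs j.succ) = t := by
  induction k generalizing m with
  | zero => exact IsDef.setOf_eq isDef_fact t
  | succ k ih =>
    have h₁ (xs : Fin (m + 1) → M) (A : M) : (Fin.snoc xs A : Fin (m + 2) → M) 0 = xs 0 :=
      Fin.snoc_castSucc (α := fun _ => M) (n := m + 1) A xs 0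
    have h₂ (xs : Fin (m + 1) → M) (A : M) :
        (fun j : Fin (m + 1) => (Fin.snoc xs A : Fin (m + 2) → M) j.succ) =
          Fin.snoc (fun j => xs j.succ) A := by
      funext j
      refine Fin.lastCases ?_ (fun j => ?_) j
      · simp [Fin.succ_last]
      · simp [Fin.succ_castSucc, -Fin.castSucc_succ]
    refine IsDef.setOf_eq (R := fun s xs => ∃ A,
      rankType (seg (xs 0)) k (Fin.snoc (fun j => xs j.succ) A : Fin (m + 1) → M) = s)
      (fun s => ?_) t
    simpa only [h₁, h₂] using (ih s).exists_snoc

theorem exists_atoms_of_isDef [M ⊨ Tbase] {R : (Fin 1 → M) → Prop} (h : IsDef R) :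
    ∃ X : M, ∀ a, atE a → (subE a X ↔ R fun _ => a) := by
  obtain ⟨η, hη⟩ := h
  obtain ⟨X, hX⟩ := exists_comprehension η (Fin.elim0 : Fin 0 → M)
  refine ⟨X, fun a ha => ((hX a ha).trans (hη _ _)).trans (iff_of_eq (congrArg R ?_))⟩
  funext i
  rw [Subsingleton.elim (α := Fin 1) i (Fin.last 0)]
  exact Fin.snoc_last (α := fun _ => M) a _

end Definability

/-! ### Comparison with finite orders -/

section Main

theorem isNext_singleton {α : Type*} [LinearOrder α] (a : α) :
    IsNext {A : Set α | ∃ b < a, A = {b}} {a} := by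
  have := models_Tbase α
  refine ⟨?_, ⟨a, rfl⟩, ?_, ?_, ?_, isModifiableAt_of_models ⟨a, rfl⟩⟩
  · rintro _ ⟨b, -, rfl⟩
    exact ⟨b, rfl⟩
  · rintro _ ⟨b, hb, rfl⟩
    exact exleE_singleton.2 hb
  · rintro _ ⟨b, hb, rfl⟩ h
    exact lt_asymm hb (exleE_singleton.1 h)
  · exact fun h => lt_irrefl a (exleE_singleton.1 h)

/-- The rank `k` type of the finite order with `j` elements, as an initial segment of `ℕ`. -/
def finType (k j : ℕ) : RankType k 0 :=
  rankType {A : Set ℕ | ∃ b < j, A = {b}} k Fin.elim0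

theorem rankType_empty_eq_finType {M : Type*} [Lmso.Structure M] (k : ℕ) :
    rankType (∅ : Set M) k Fin.elim0 = finType k 0 := by
  have : Nonempty M := ⟨botE M⟩
  have h : {A : Set ℕ | ∃ b < 0, A = {b}} = ∅ := by simp
  rw [finType, h]
  exact rankType_empty k _ _

theorem IsNext.rankType_insert_eq_finType {M : Type*} [Lmso.Structure M] {P : Set M} {a : M}
    (ha : IsNext P a) {k j : ℕ} (h : rankType P k Fin.elim0 = finType k j) :
    rankType (insert a P) k Fin.elim0 = finType k (j + 1) := by
  have h' : {A : Set ℕ | ∃ b < j + 1, A = {b}} = insert {j} {A : Set ℕ | ∃ b < j, A = {b}} := by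
    ext A
    constructor
    · rintro ⟨b, hb, rfl⟩
      rcases Nat.lt_succ_iff_lt_or_eq.1 hb with h | rfl
      · exact Or.inr ⟨b, h, rfl⟩
      · exact Or.inl rfl
    · rintro (rfl | ⟨b, hb, rfl⟩)
      · exact ⟨_, Nat.lt_succ_self j, rfl⟩
      · exact ⟨b, Nat.lt_succ_of_lt hb, rfl⟩
  rw [finType, h']
  exact ha.rankType_insert (isNext_singleton j) k h fun i => i.elim0

theorem rankType_MSOn_eq_finType (n k : ℕ) :
    rankType {a : MSOn n | atE a} k Fin.elim0 = finType k n := by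
  have key : ∀ j ≤ n, rankType {A : MSOn n | ∃ b : Fin n, b.val < j ∧ A = {b}} k Fin.elim0 =
      finType k j := by
    intro j
    induction j with
    | zero =>
      intro _
      have h : {A : MSOn n | ∃ b : Fin n, b.val < 0 ∧ A = {b}} = ∅ := by simp
      rw [h]
      exact rankType_empty_eq_finType k
    | succ j ih =>
      intro hj
      have h : {A : MSOn n | ∃ b : Fin n, b.val < j + 1 ∧ A = {b}} =
          insert {⟨j, hj⟩} {A : MSOn n | ∃ b : Fin n, b.val < j ∧ A = {b}} := by
        ext A
        constructor
        · rintro ⟨b, hb, rfl⟩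
          rcases Nat.lt_succ_iff_lt_or_eq.1 hb with h | h
          · exact Or.inr ⟨b, h, rfl⟩
          · exact Or.inl (congrArg _ (Fin.ext h))
        · rintro (rfl | ⟨b, hb, rfl⟩)
          · exact ⟨_, Nat.lt_succ_self j, rfl⟩
          · exact ⟨b, Nat.lt_succ_of_lt hb, rfl⟩
      rw [h]
      exact (isNext_singleton (⟨j, hj⟩ : Fin n)).rankType_insert_eq_finType
        (ih (Nat.le_of_succ_le hj))
  have h : {a : MSOn n | atE a} = {A : MSOn n | ∃ b : Fin n, b.val < n ∧ A = {b}} := by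
    ext A
    exact exists_congr fun b => (and_iff_right b.isLt).symm
  rw [h]
  exact key n le_rfl

variable (M : Type*) [Lmso.Structure M] [M ⊨ TMSOFin]

theorem exists_rankType_seg_eq_finType (k : ℕ) (a : M) (ha : atE a) :
    ∃ j, rankType (seg a) k Fin.elim0 = finType k j := by
  have ax {φ : Lmso.Sentence} (h : φ ∈ TMSOFin) : M ⊨ φ := TMSOFin.realize_sentence_of_mem h
  have : M ⊨ Tbase := Theory.Model.mono ‹_› Set.subset_union_left
  have hset := isSetLike_of_models M
  have hirrefl := models_axIrrefl.1 (ax (by simp [TMSOFin, Tbase]))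
  have htrans := models_axTransAt.1 (ax (by simp [TMSOFin, Tbase]))
  have htrich := models_axTrich.1 (ax (by simp [TMSOFin, Tbase]))
  have hpred := models_axPred.1 (ax (by simp [TMSOFin]))
  have hleast := models_axLeastIn.1 (ax (by simp [TMSOFin]))
  have hdef : IsDef fun xs : Fin 1 → M => ∀ t : Set.range (finType k),
      ¬ rankType (seg (xs 0)) k (fun j : Fin 0 => xs j.succ) = t.1 :=
    IsDef.forall fun t => (isDef_rankType_eq k t.1).not
  obtain ⟨X, hX⟩ := exists_atoms_of_isDef hdef
  have hX' (b : M) (hb : atE b) :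
      subE b X ↔ ∀ j, ¬ rankType (seg b) k Fin.elim0 = finType k j := by
    rw [hX b hb, Set.forall_subtype_range_iff]
    simp only [Subsingleton.elim (fun _ : Fin 0 => b) Fin.elim0]
  by_contra hcon
  have hne : X ≠ botE M := by
    rintro rfl
    exact hset.not_subE_bot a ha ((hX' a ha).2 (not_exists.1 hcon))
  obtain ⟨b, ⟨hb, hbX⟩, hmin⟩ := hleast X hne
  have hbad := (hX' b hb).1 hbX
  suffices H : ∃ P : Set M, seg b = insert b P ∧ IsNext P b ∧
      ∃ j, rankType P k Fin.elim0 = finType k j by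
    obtain ⟨P, hP, hnext, j, hj⟩ := H
    exact hbad (j + 1) (hP ▸ hnext.rankType_insert_eq_finType hj)
  by_cases hex : ∃ c, atE c ∧ exleE c b
  · obtain ⟨c, ⟨⟨hc, -⟩, hcb⟩, hsucc⟩ := hpred b hb hex
    have hlt : ∀ d ∈ seg c, exleE d b := by
      rintro d ⟨hd, hcd⟩
      rcases htrich c d hc hd with (h | rfl) | h
      · exact absurd h hcd
      · exact hcb
      · exact htrans d c b hd hc hb h hcb
    refine ⟨seg c, ?_, ⟨fun d hd => hd.1, hb, hlt, ?_, hirrefl b hb,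
      isModifiableAt_of_models hb⟩, ?_⟩
    · ext d
      constructor
      · rintro ⟨hd, hbd⟩
        by_cases hcd : exleE c d
        · exact Or.inl ((hsucc d hd hcd).resolve_right hbd)
        · exact Or.inr ⟨hd, hcd⟩
      · rintro (rfl | hd)
        · exact ⟨hb, hirrefl d hb⟩
        · exact ⟨hd.1, fun h => hirrefl b hb (htrans b d b hb hd.1 hb h (hlt d hd))⟩
    · exact fun d hd h => hirrefl b hb (htrans b d b hb hd.1 hb h (hlt d hd))
    · have := mt (hX' c hc).2 fun h => hmin c hc h hcb
      simpa using this
  · refine ⟨∅, ?_, ⟨by simp, hb, by simp, by simp, hirrefl b hb, isModifiableAt_of_models hb⟩,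
      0, rankType_empty_eq_finType k⟩
    ext d
    constructor
    · rintro ⟨hd, hbd⟩
      rcases htrich b d hb hd with (h | rfl) | h
      · exact absurd h hbd
      · exact Or.inl rfl
      · exact absurd ⟨d, hd, h⟩ hex
    · rintro (rfl | hd)
      · exact ⟨hb, hirrefl d hb⟩
      · exact absurd hd (Set.notMem_empty d)

theorem exists_rankType_eq_finType (k : ℕ) :
    ∃ j, rankType {a : M | atE a} k Fin.elim0 = finType k j := by
  by_cases hex : ∃ a : M, atE a
  · obtain ⟨a, ha, hmax⟩ :=
      models_axGreatestAtom.1 (TMSOFin.realize_sentence_of_mem (M := M) (by simp [TMSOFin])) hex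
    have h : {a : M | atE a} = seg a := Set.ext fun b => ⟨fun hb => ⟨hb, hmax b hb⟩, And.left⟩
    rw [h]
    exact exists_rankType_seg_eq_finType M k a ha
  · have h : {a : M | atE a} = ∅ := Set.eq_empty_of_forall_notMem fun a ha => hex ⟨a, ha⟩
    exact ⟨0, h ▸ rankType_empty_eq_finType k⟩

theorem exists_MSOn_iff (φ : Lmso.Sentence) : ∃ n, M ⊨ φ ↔ MSOn n ⊨ φ := by
  have : M ⊨ Tbase := Theory.Model.mono ‹_› Set.subset_union_left
  obtain ⟨n, hn⟩ := exists_rankType_eq_finType M (qr φ)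
  have : MSOn n ⊨ Tbase := models_Tbase (Fin n)
  refine ⟨n, realize_iff_of_rankType_eq (isSetLike_of_models M) (isSetLike_of_models (MSOn n))
    (k := qr φ) ?_ φ le_rfl _ _⟩
  have hM := congrArg (rankType {a : M | atE a} (qr φ)) (Subsingleton.elim default Fin.elim0)
  exact ((hM.trans hn).trans (rankType_MSOn_eq_finType n (qr φ)).symm).trans
    (congrArg (rankType _ (qr φ)) (Subsingleton.elim _ _))

end Main

theorem statement7 (φ : Lmso.Sentence) :
    TMSOFin ⊨ᵇ φ ↔ ∀ n : ℕ, MSOn n ⊨ φ := by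
  rw [Theory.models_sentence_iff]
  constructor
  · intro h n
    have := models_TMSOFin_MSOn n
    exact h (Theory.ModelType.of TMSOFin (MSOn n))
  · intro h M
    obtain ⟨n, hn⟩ := exists_MSOn_iff M φ
    exact hn.2 (h n)

end MSO
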